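/- Let p be a prime, let a be a positive integer, and let m, n be nonnegative integers with m ≥ n. Then C(p^a·m, p^a·n) / C(m, n) ≡ 1 + [p=2]·p·n·(m−n) (mod p^{2 + v_p(n)}), where v_p(n) is the p-adic valuation of n (with v_p(0) = +∞, in which case the congruence is an equality). -/

import Mathlib

/-- `x ≡ y (mod p^r)` for rational numbers: `(x - y)/p^r` has nonnegative `p`-adic valuation. -/
def IsCongr (p r : ℕ) (x y : ℚ) : Prop := 0 ≤ padicValRat p ((x - y) / (p : ℚ) ^ r)

open Polynomial in
theorem prime_dvd_derivative_ascPochhammer_eval_one {p : ℕ} (hp : p.Prime) (h2 : p ≠ 2) :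
    (p : ℤ) ∣ (derivative (ascPochhammer ℤ (p - 1))).eval 1 := by
  obtain ⟨k, hk⟩ := (ascPochhammer ℤ (p - 1)).binomExpansion 1 (-(p : ℤ))
  have hone : (ascPochhammer ℤ (p - 1)).eval 1 = ((p - 1).factorial : ℤ) :=
    ascPochhammer_eval_one ℤ (p - 1)
  have hneg : (ascPochhammer ℤ (p - 1)).eval (1 + -(p : ℤ)) = ((p - 1).factorial : ℤ) := by
    have h : (1 + -(p : ℤ)) = -((p - 1 : ℕ) : ℤ) := by
      rw [Nat.cast_sub hp.one_le]; push_cast; ring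
    rw [h, ascPochhammer_eval_neg_eq_descPochhammer, descPochhammer_eval_eq_descFactorial,
      Nat.descFactorial_self, (hp.even_sub_one h2).neg_one_pow, one_mul]
  rw [hone, hneg] at hk
  have hp0 : (p : ℤ) ≠ 0 := by exact_mod_cast hp.ne_zero
  exact ⟨k, mul_left_cancel₀ hp0 (by linear_combination hk)⟩

open Polynomial in
theorem sq_mul_dvd_ascPochhammer_eval_sub {p : ℕ} (hp : p.Prime) (h2 : p ≠ 2) (n d : ℤ) :
    (p : ℤ) ^ 2 * n ∣ (ascPochhammer ℤ (p - 1)).eval (p * d + 1 + p * n) -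
      (ascPochhammer ℤ (p - 1)).eval (p * d + 1) := by
  obtain ⟨k, hk⟩ := (ascPochhammer ℤ (p - 1)).binomExpansion (p * d + 1) (p * n)
  obtain ⟨s, hs⟩ := prime_dvd_derivative_ascPochhammer_eval_one hp h2
  obtain ⟨t, ht⟩ :=
    sub_dvd_eval_sub (p * d + 1 : ℤ) 1 (derivative (ascPochhammer ℤ (p - 1)))
  exact ⟨s + d * t + k * n, by linear_combination hk + (p : ℤ) * n * (ht + hs)⟩

theorem not_prime_dvd_ascFactorial {p : ℕ} (hp : p.Prime) (d : ℕ) :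
    ¬ p ∣ (p * d + 1).ascFactorial (p - 1) := by
  rw [Nat.ascFactorial_eq_prod_range, hp.prime.dvd_finsetProd_iff]
  rintro ⟨i, hi, h⟩
  rw [add_assoc, Nat.dvd_add_right (dvd_mul_right p d)] at h
  have := Nat.le_of_dvd (by omega) h
  have := Finset.mem_range.1 hi
  omega

theorem factorial_mul_succ_eq {p : ℕ} (hp : 0 < p) (d : ℕ) :
    (p * (d + 1)).factorial =
      (p * d).factorial * (p * d + 1).ascFactorial (p - 1) * (p * (d + 1)) := by
  have h : p * (d + 1) = (p * d + (p - 1)) + 1 := by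
    rw [mul_add]; omega
  rw [Nat.factorial_mul_ascFactorial, h, Nat.factorial_succ, mul_comm]

/-- `x` is `p`-integral and congruent to `c` modulo `M`, up to a denominator prime to `p`. -/
def IsCongrInt (p : ℕ) (M c : ℤ) (x : ℚ) : Prop :=
  ∃ A B : ℤ, ¬ (p : ℤ) ∣ B ∧ x * B = A ∧ M ∣ A - B * c

namespace IsCongrInt

theorem mul {p : ℕ} (hp : p.Prime) {M c c' : ℤ} {x y : ℚ} (hx : IsCongrInt p M c x)
    (hy : IsCongrInt p M c' y) : IsCongrInt p M (c * c') (x * y) := by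
  obtain ⟨A, B, hB, hAB, s, hs⟩ := hx
  obtain ⟨A', B', hB', hAB', t, ht⟩ := hy
  refine ⟨A * A', B * B', (Nat.prime_iff_prime_int.1 hp).not_dvd_mul hB hB', ?_,
    s * A' + B * c * t, ?_⟩
  · push_cast
    rw [← hAB, ← hAB']
    ring
  · linear_combination A' * hs + B * c * ht

theorem congr {p : ℕ} {M M' c c' : ℤ} {x : ℚ} (hx : IsCongrInt p M c x) (hM : M' ∣ M)
    (hc : M' ∣ c - c') : IsCongrInt p M' c' x := by
  obtain ⟨A, B, hB, hAB, h⟩ := hx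
  refine ⟨A, B, hB, hAB, ?_⟩
  have hsum := dvd_add (hM.trans h) (hc.mul_left B)
  rwa [mul_sub, sub_add_sub_cancel] at hsum

theorem isCongr {p r : ℕ} (hp : p.Prime) {c : ℤ} {x : ℚ} (hx : IsCongrInt p ((p : ℤ) ^ r) c x) :
    IsCongr p r x c := by
  obtain ⟨A, B, hB, hAB, t, ht⟩ := hx
  have := Fact.mk hp
  have hp0 : (p : ℚ) ≠ 0 := by exact_mod_cast hp.ne_zero
  have hB0 : B ≠ 0 := by rintro rfl; exact hB (dvd_zero _)
  have hBq : (B : ℚ) ≠ 0 := by exact_mod_cast hB0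
  have htq : (A : ℚ) - B * c = (p : ℚ) ^ r * t := by exact_mod_cast ht
  have key : (x - c) / (p : ℚ) ^ r = t / B := by
    rw [div_eq_div_iff (pow_ne_zero _ hp0) hBq]
    linear_combination hAB + htq
  unfold IsCongr
  rw [key]
  rcases eq_or_ne t 0 with rfl | ht0
  · simp
  · rw [padicValRat.div (by exact_mod_cast ht0) hBq, padicValRat.of_int, padicValRat.of_int,
      padicValInt.eq_zero_of_not_dvd hB]
    simp

end IsCongrInt

open Polynomial in
theorem isCongrInt_ascFactorial_div {p : ℕ} (hp : p.Prime) (n d : ℕ) :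
    IsCongrInt p ((p : ℤ) ^ 2 * n) (1 + (if p = 2 then 1 else 0) * p * n)
      (((p * (n + d) + 1).ascFactorial (p - 1) : ℚ) / (p * d + 1).ascFactorial (p - 1)) := by
  refine ⟨(p * (n + d) + 1).ascFactorial (p - 1), (p * d + 1).ascFactorial (p - 1),
    by exact_mod_cast not_prime_dvd_ascFactorial hp d, ?_, ?_⟩
  · have : ((p * d + 1).ascFactorial (p - 1) : ℚ) ≠ 0 := by
      exact_mod_cast (Nat.ascFactorial_pos _ _).ne'
    push_cast
    field_simp
  · split_ifs with h2
    · subst h2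
      refine ⟨-d, ?_⟩
      simp [Nat.ascFactorial]
      ring
    · have h := sq_mul_dvd_ascPochhammer_eval_sub hp h2 n d
      have e (k : ℕ) :
          ((k.ascFactorial (p - 1) : ℕ) : ℤ) = (ascPochhammer ℤ (p - 1)).eval (k : ℤ) := by
        rw [← ascPochhammer_nat_eq_ascFactorial, ascPochhammer_eval_cast]
      rw [e, e]
      convert h using 1
      push_cast
      ring_nf

theorem choose_mul_div_choose_succ {p : ℕ} (hp : 0 < p) (n d : ℕ) :
    ((p * (n + (d + 1))).choose (p * n) : ℚ) / (n + (d + 1)).choose n =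
      ((p * (n + d)).choose (p * n) : ℚ) / (n + d).choose n *
        (((p * (n + d) + 1).ascFactorial (p - 1) : ℚ) / (p * d + 1).ascFactorial (p - 1)) := by
  have hf (k : ℕ) : (k.factorial : ℚ) ≠ 0 := by exact_mod_cast k.factorial_ne_zero
  have ha (k : ℕ) : ((p * k + 1).ascFactorial (p - 1) : ℚ) ≠ 0 := by
    exact_mod_cast (Nat.ascFactorial_pos _ _).ne'
  have hpq : (p : ℚ) ≠ 0 := by exact_mod_cast hp.ne'
  rw [mul_add p n (d + 1), mul_add p n d, Nat.cast_add_choose, Nat.cast_add_choose,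
    Nat.cast_add_choose, Nat.cast_add_choose, ← mul_add, ← mul_add, ← add_assoc n d 1,
    factorial_mul_succ_eq hp, factorial_mul_succ_eq hp, Nat.factorial_succ, Nat.factorial_succ]
  have h1 : ((d : ℚ) + 1) ≠ 0 := by positivity
  have h2 : ((n : ℚ) + d + 1) ≠ 0 := by positivity
  have := hf (p * n)
  have := hf (p * d)
  have := hf n
  have := hf d
  have := hf (n + d)
  have := hf (p * (n + d))
  have := ha d
  have := ha (n + d)
  push_cast
  field_simp

theorem isCongrInt_choose_mul_div_choose {p : ℕ} (hp : p.Prime) (n d : ℕ) :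
    IsCongrInt p ((p : ℤ) ^ 2 * n) (1 + (if p = 2 then 1 else 0) * p * n * d)
      (((p * (n + d)).choose (p * n) : ℚ) / (n + d).choose n) := by
  induction d with
  | zero => exact ⟨1, 1, by exact_mod_cast hp.not_dvd_one, by simp, by simp⟩
  | succ d ih =>
    rw [choose_mul_div_choose_succ hp.pos]
    refine (ih.mul hp (isCongrInt_ascFactorial_div hp n d)).congr dvd_rfl ?_
    refine ⟨(if p = 2 then 1 else 0) * n * d, ?_⟩
    split_ifs <;> push_cast <;> ring

theorem isCongrInt_choose_pow_mul_div_choose {p : ℕ} (hp : p.Prime) (n d a : ℕ) :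
    IsCongrInt p ((p : ℤ) ^ 2 * n) (1 + (if p = 2 then 1 else 0) * p * n * d)
      (((p ^ (a + 1) * (n + d)).choose (p ^ (a + 1) * n) : ℚ) / (n + d).choose n) := by
  induction a with
  | zero => simpa using isCongrInt_choose_mul_div_choose hp n d
  | succ a ih =>
    have h := (isCongrInt_choose_mul_div_choose hp (p ^ (a + 1) * n) (p ^ (a + 1) * d)).congr
      (M' := (p : ℤ) ^ 2 * n) (c' := 1) ⟨(p : ℤ) ^ (a + 1), by push_cast; ring⟩
      ⟨(if p = 2 then 1 else 0) * p ^ (2 * a + 1) * d, by push_cast; ring⟩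
    rw [← mul_add, ← mul_assoc, ← mul_assoc, ← pow_succ'] at h
    have h0 : ((p ^ (a + 1) * (n + d)).choose (p ^ (a + 1) * n) : ℚ) ≠ 0 := by
      exact_mod_cast (Nat.choose_pos (Nat.mul_le_mul_left _ (Nat.le_add_right n d))).ne'
    have hmul := h.mul hp ih
    rwa [div_mul_div_cancel₀ h0, one_mul] at hmul

theorem stmt14 (p a m n : ℕ) (hp : p.Prime) (ha : 0 < a) (hmn : n ≤ m) :
    (n = 0 →
      ((p ^ a * m).choose (p ^ a * n) : ℚ) / (m.choose n : ℚ)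
        = 1 + (if p = 2 then 1 else 0) * p * n * ((m : ℚ) - n)) ∧
    (n ≠ 0 →
      IsCongr p (2 + padicValNat p n)
        (((p ^ a * m).choose (p ^ a * n) : ℚ) / (m.choose n : ℚ))
        (1 + (if p = 2 then 1 else 0) * p * n * ((m : ℚ) - n))) := by
  refine ⟨by rintro rfl; simp, fun _ => ?_⟩
  obtain ⟨d, rfl⟩ := Nat.exists_eq_add_of_le hmn
  obtain ⟨b, rfl⟩ := Nat.exists_eq_add_of_le' ha
  have hdvd : (p : ℤ) ^ (2 + padicValNat p n) ∣ (p : ℤ) ^ 2 * n := by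
    rw [pow_add]
    exact mul_dvd_mul_left _ (by exact_mod_cast pow_padicValNat_dvd)
  have h := ((isCongrInt_choose_pow_mul_div_choose hp n d b).congr hdvd
    (by rw [sub_self]; exact dvd_zero _)).isCongr hp
  convert h using 1
  push_cast
  ring
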